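/- arXiv:0904.3482 — 8 statements merged into one kernel-verified Lean document; each statement's English description precedes it below -/
import Mathlib

section
/- Let S be a subset of the real numbers. Then S equals the set of natural numbers in ℝ if and only if the following three conditions hold: (i) 0 ∈ S; (ii) for every x ∈ S, 0 ≤ x and x + 1 ∈ S; and (iii) for all x, y ∈ S with x ≠ y, |x − y| ≥ 1. -/
theorem stmt_0 (S : Set ℝ) :
    S = Set.range (Nat.cast : ℕ → ℝ) ↔
      ((0 : ℝ) ∈ S ∧ (∀ x ∈ S, 0 ≤ x ∧ x + 1 ∈ S) ∧
        ∀ x ∈ S, ∀ y ∈ S, x ≠ y → 1 ≤ |x - y|) := by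
  constructor
  · rintro rfl
    refine ⟨⟨0, Nat.cast_zero⟩, ?_, ?_⟩
    · rintro _ ⟨n, rfl⟩
      exact ⟨n.cast_nonneg, n + 1, by push_cast; rfl⟩
    · rintro _ ⟨m, rfl⟩ _ ⟨n, rfl⟩ hne
      have h : (m : ℤ) - n ≠ 0 := sub_ne_zero.mpr fun h ↦ hne (by exact_mod_cast h)
      exact_mod_cast Int.one_le_abs h
  · rintro ⟨h0, hsucc, hsep⟩
    have hnat : ∀ n : ℕ, (n : ℝ) ∈ S := by
      intro n
      induction n with
      | zero => simpa using h0
      | succ n ih => simpa using (hsucc _ ih).2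
    refine Set.Subset.antisymm (fun x hx ↦ ⟨⌊x⌋₊, ?_⟩) (Set.range_subset_iff.mpr hnat)
    by_contra hne
    have hle := Nat.floor_le (hsucc x hx).1
    have hlt := Nat.lt_floor_add_one x
    have h := hsep x hx _ (hnat ⌊x⌋₊) (Ne.symm hne)
    rw [abs_of_nonneg (sub_nonneg.mpr hle)] at h
    linarith
end

section
/- Let V be a real normed space and let v₀, …, vₙ ∈ V (n ≥ 1) be affinely independent points with ‖vᵢ‖ = 1 for every i. Suppose u = ∑ᵢ aᵢ·vᵢ is a proper convex combination (each aᵢ > 0 and ∑ᵢ aᵢ = 1) with ‖u‖ = 1. Then every x in the convex hull of {v₀, …, vₙ} satisfies ‖x‖ = 1. -/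
/-- If a convex combination with positive weights of points of the unit sphere lies on the unit
sphere, then so does the whole convex hull of these points. -/
theorem norm_eq_one_of_mem_convexHull_of_norm_sum_eq_one {ι V : Type*} [Fintype ι]
    [NormedAddCommGroup V] [NormedSpace ℝ V] {v : ι → V} (hunit : ∀ i, ‖v i‖ = 1)
    {a : ι → ℝ} (hpos : ∀ i, 0 < a i) (hsum : ∑ i, a i = 1) (hu : ‖∑ i, a i • v i‖ = 1)
    {x : V} (hx : x ∈ convexHull ℝ (Set.range v)) : ‖x‖ = 1 := by
  obtain ⟨f, hf, hfu⟩ := exists_dual_vector'' ℝ (∑ i, a i • v i)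
  have hf_le (y : V) : f y ≤ ‖y‖ :=
    (le_abs_self _).trans ((f.le_of_opNorm_le hf y).trans_eq (one_mul _))
  have hfv_le (i : ι) : a i * f (v i) ≤ a i :=
    mul_le_of_le_one_right (hpos i).le ((hf_le _).trans_eq (hunit i))
  have hfsum : ∑ i, a i * f (v i) = ∑ i, a i := by
    simpa [hu, hsum] using hfu
  have hfv (i : ι) : f (v i) = 1 := by
    have h := (Finset.sum_eq_sum_iff_of_le fun i _ => hfv_le i).1 hfsum i (Finset.mem_univ i)
    exact (mul_eq_left₀ (hpos i).ne').1 h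
  have hball : x ∈ Metric.closedBall (0 : V) 1 :=
    convexHull_min (Set.range_subset_iff.2 fun i => by simp [hunit i])
      (convex_closedBall _ _) hx
  have hplane : x ∈ {y | f y = 1} :=
    convexHull_min (Set.range_subset_iff.2 hfv)
      (convex_hyperplane f.toLinearMap.isLinear 1) hx
  exact le_antisymm (mem_closedBall_zero_iff.1 hball) (hplane.symm.trans_le (hf_le x))

theorem stmt_4 {V : Type*} [NormedAddCommGroup V] [NormedSpace ℝ V]
    (n : ℕ) (hn : 1 ≤ n) (v : Fin (n + 1) → V)
    (hindep : AffineIndependent ℝ v)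
    (hunit : ∀ i, ‖v i‖ = 1)
    (a : Fin (n + 1) → ℝ) (hpos : ∀ i, 0 < a i) (hsum : ∑ i, a i = 1)
    (hu : ‖∑ i, a i • v i‖ = 1) :
    ∀ x ∈ convexHull ℝ (Set.range v), ‖x‖ = 1 :=
  fun _ hx => norm_eq_one_of_mem_convexHull_of_norm_sum_eq_one hunit hpos hsum hu hx
end

section
/- Let V be a real normed space and let x, y ∈ V. Then there exist real numbers a, b and a vector z ∈ V such that ‖z + y‖ = ‖z − y‖ and x = a·y + b·z. (That is, y together with the set {z | ‖z + y‖ = ‖z − y‖} spans V.) -/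
theorem exists_norm_sub_le_norm_add {V : Type*} [NormedAddCommGroup V] [NormedSpace ℝ V]
    (x : V) {y : V} (hy : y ≠ 0) :
    ∃ t : ℝ, ‖x + t • y - y‖ ≤ ‖x + t • y + y‖ := by
  by_contra! h
  have bound (n : ℕ) : ‖x + (2 * n : ℝ) • y‖ ≤ ‖x‖ := by
    induction n with
    | zero => simp
    | succ n ih =>
      have hn := h (2 * n + 1)
      rw [show x + (2 * n + 1 : ℝ) • y + y = x + (2 * (n + 1 : ℕ) : ℝ) • y by
          push_cast; module,
        show x + (2 * n + 1 : ℝ) • y - y = x + (2 * n : ℝ) • y by module] at hn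
      exact hn.le.trans ih
  have hy' : 0 < ‖y‖ := norm_pos_iff.mpr hy
  obtain ⟨n, hn⟩ := exists_nat_gt (‖x‖ / ‖y‖)
  rw [div_lt_iff₀ hy'] at hn
  have key : ‖(2 * n : ℝ) • y‖ ≤ ‖x + (2 * n : ℝ) • y‖ + ‖x‖ := by
    simpa using norm_sub_le (x + (2 * n : ℝ) • y) x
  rw [norm_smul, Real.norm_of_nonneg (by positivity)] at key
  linarith [bound n]

theorem exists_norm_add_eq_norm_sub {V : Type*} [NormedAddCommGroup V] [NormedSpace ℝ V]
    (x y : V) : ∃ t : ℝ, ‖x + t • y + y‖ = ‖x + t • y - y‖ := by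
  rcases eq_or_ne y 0 with rfl | hy
  · exact ⟨0, by simp⟩
  obtain ⟨s, hs⟩ := exists_norm_sub_le_norm_add x hy
  obtain ⟨t, ht⟩ := exists_norm_sub_le_norm_add x (neg_ne_zero.mpr hy)
  rw [sub_neg_eq_add, ← sub_eq_add_neg, smul_neg, ← neg_smul] at ht
  exact mem_range_of_exists_le_of_exists_ge
    (f := fun t : ℝ => ‖x + t • y + y‖ - ‖x + t • y - y‖) (c := 0) (by fun_prop)
    ⟨-t, sub_nonpos.mpr ht⟩ ⟨s, sub_nonneg.mpr hs⟩ |>.imp fun _ => sub_eq_zero.mp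

theorem stmt_5 {V : Type*} [NormedAddCommGroup V] [NormedSpace ℝ V]
    (x y : V) :
    ∃ (a b : ℝ) (z : V), ‖z + y‖ = ‖z - y‖ ∧ x = a • y + b • z := by
  obtain ⟨t, ht⟩ := exists_norm_add_eq_norm_sub x y
  exact ⟨-t, 1, x + t • y, ht, by module⟩
end

section
/- Let D ⊆ ℝ × ℝ be the convex hull of the set E = {(1,0), (−1,0)} ∪ {±(i,1)/√(i²+1) | i ∈ ℤ}, and let ‖v‖_X denote the gauge (Minkowski functional) of D at v, which is a norm on ℝ × ℝ. Then for every v ∈ ℝ × ℝ, ‖v − (1,0)‖_X = ‖v + (1,0)‖_X if and only if the first coordinate of v is 0. -/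
/-- The set `E = {(1,0), (−1,0)} ∪ {±(i,1)/√(i²+1) | i ∈ ℤ}`. -/
noncomputable def Eset : Set (ℝ × ℝ) :=
  {((1 : ℝ), (0 : ℝ)), ((-1 : ℝ), (0 : ℝ))} ∪
    ⋃ i : ℤ,
      {(Real.sqrt ((i : ℝ) ^ 2 + 1))⁻¹ • (((i : ℝ), (1 : ℝ)) : ℝ × ℝ),
        -((Real.sqrt ((i : ℝ) ^ 2 + 1))⁻¹ • (((i : ℝ), (1 : ℝ)) : ℝ × ℝ))}

open scoped Pointwise

lemma mem_Eset_iff {p : ℝ × ℝ} :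
    p ∈ Eset ↔ p = (1, 0) ∨ p = (-1, 0) ∨ ∃ i : ℤ,
      p = (√((i : ℝ) ^ 2 + 1))⁻¹ • ((i : ℝ), (1 : ℝ)) ∨
        p = -((√((i : ℝ) ^ 2 + 1))⁻¹ • ((i : ℝ), (1 : ℝ))) := by
  simp only [Eset, Set.mem_union, Set.mem_insert_iff, Set.mem_singleton_iff, Set.mem_iUnion,
    or_assoc]

/-- Reflection of the plane in the second coordinate axis. -/
def reflectFst : (ℝ × ℝ) →ₗ[ℝ] (ℝ × ℝ) :=
  (-LinearMap.id).prodMap LinearMap.id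

lemma reflectFst_apply (p : ℝ × ℝ) : reflectFst p = (-p.1, p.2) := rfl

lemma reflectFst_reflectFst (p : ℝ × ℝ) : reflectFst (reflectFst p) = p := by
  simp [reflectFst_apply]

lemma reflectFst_mem_Eset {p : ℝ × ℝ} (hp : p ∈ Eset) : reflectFst p ∈ Eset := by
  rw [mem_Eset_iff] at hp ⊢
  rcases hp with rfl | rfl | ⟨i, rfl | rfl⟩
  · simp [reflectFst_apply]
  · simp [reflectFst_apply]
  · exact Or.inr (Or.inr ⟨-i, Or.inl (by simp [reflectFst_apply])⟩)
  · exact Or.inr (Or.inr ⟨-i, Or.inr (by simp [reflectFst_apply])⟩)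

lemma reflectFst_mem_convexHull {p : ℝ × ℝ} (hp : p ∈ convexHull ℝ Eset) :
    reflectFst p ∈ convexHull ℝ Eset := by
  have h : reflectFst p ∈ reflectFst '' convexHull ℝ Eset := ⟨p, hp, rfl⟩
  rw [reflectFst.image_convexHull] at h
  refine convexHull_mono ?_ h
  rintro _ ⟨q, hq, rfl⟩
  exact reflectFst_mem_Eset hq

lemma gauge_reflectFst (p : ℝ × ℝ) :
    gauge (convexHull ℝ Eset) (reflectFst p) = gauge (convexHull ℝ Eset) p := by
  have key : ∀ (r : ℝ) (q : ℝ × ℝ), q ∈ r • convexHull ℝ Eset →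
      reflectFst q ∈ r • convexHull ℝ Eset := by
    rintro r _ ⟨q, hq, rfl⟩
    exact ⟨reflectFst q, reflectFst_mem_convexHull hq, (reflectFst.map_smul r q).symm⟩
  unfold gauge
  congr 1
  ext r
  refine and_congr_right fun _ => ⟨fun h => ?_, key r p⟩
  simpa only [reflectFst_reflectFst] using key r _ h

lemma axis_mem_convexHull {t : ℝ} (ht : |t| ≤ 1) :
    ((t, 0) : ℝ × ℝ) ∈ convexHull ℝ Eset ∧ ((0, t) : ℝ × ℝ) ∈ convexHull ℝ Eset := by
  obtain ⟨h1, h2⟩ := abs_le.1 ht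
  have hE : ∀ p ∈ Eset, p ∈ convexHull ℝ Eset := fun p hp => subset_convexHull ℝ Eset hp
  have hc := convex_convexHull ℝ Eset
  have ha : (0 : ℝ) ≤ (1 + t) / 2 := by linarith
  have hb : (0 : ℝ) ≤ (1 - t) / 2 := by linarith
  constructor
  · have := hc (hE (1, 0) (mem_Eset_iff.2 (Or.inl rfl)))
      (hE (-1, 0) (mem_Eset_iff.2 (Or.inr (Or.inl rfl)))) ha hb (by ring)
    convert this using 1
    ext <;> simp
    ring
  · have := hc (hE (0, 1) (mem_Eset_iff.2 (Or.inr (Or.inr ⟨0, Or.inl (by simp)⟩))))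
      (hE (0, -1) (mem_Eset_iff.2 (Or.inr (Or.inr ⟨0, Or.inr (by simp)⟩)))) ha hb (by ring)
    convert this using 1
    ext <;> simp
    ring

lemma absorbent_convexHull_Eset : Absorbent ℝ (convexHull ℝ Eset) := by
  refine absorbent_nhds_zero (Filter.mem_of_superset
    (Metric.ball_mem_nhds 0 (by norm_num : (0 : ℝ) < 1 / 2)) fun p hp => ?_)
  rw [mem_ball_zero_iff, Prod.norm_def, max_lt_iff, Real.norm_eq_abs, Real.norm_eq_abs] at hp
  have hx : |2 * p.1| ≤ 1 := by rw [abs_mul, abs_two]; linarith [hp.1]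
  have hy : |2 * p.2| ≤ 1 := by rw [abs_mul, abs_two]; linarith [hp.2]
  have := convex_convexHull ℝ Eset (axis_mem_convexHull hx).1 (axis_mem_convexHull hy).2
    (by norm_num : (0 : ℝ) ≤ 1 / 2) (by norm_num : (0 : ℝ) ≤ 1 / 2) (by norm_num)
  convert this using 1
  ext <;> simp

lemma abs_mul_fst_add_snd_le_one_of_mem_Eset {c : ℝ} (hc : |c| = 1 / 4) {p : ℝ × ℝ}
    (hp : p ∈ Eset) :
    |c * p.1 + p.2| ≤ 1 := by
  have key : ∀ i : ℤ, |c * ((√((i : ℝ) ^ 2 + 1))⁻¹ * i) + (√((i : ℝ) ^ 2 + 1))⁻¹| ≤ 1 := by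
    intro i
    have hs : 0 < √((i : ℝ) ^ 2 + 1) := Real.sqrt_pos.2 (by positivity)
    have hi : |(i : ℝ)| ≤ (i : ℝ) ^ 2 := by
      have : |i| ≤ i ^ 2 := by
        simpa using Int.le_self_sq |i|
      exact_mod_cast this
    have hci : c * i ≤ 1 / 4 * |(i : ℝ)| := by
      rw [← hc, ← abs_mul]; exact le_abs_self _
    have hc2 : c ^ 2 = 1 / 16 := by rw [← sq_abs, hc]; norm_num
    have hle : |c * i + 1| ≤ √((i : ℝ) ^ 2 + 1) := by
      refine Real.abs_le_sqrt ?_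
      nlinarith [sq_nonneg (i : ℝ)]
    rw [show c * ((√((i : ℝ) ^ 2 + 1))⁻¹ * i) + (√((i : ℝ) ^ 2 + 1))⁻¹
      = (c * i + 1) / √((i : ℝ) ^ 2 + 1) by ring, abs_div, abs_of_pos hs]
    exact (div_le_one hs).2 hle
  rcases mem_Eset_iff.1 hp with rfl | rfl | ⟨i, rfl | rfl⟩
  · norm_num [hc]
  · norm_num [hc]
  · simpa using key i
  · rw [← abs_neg]
    convert key i using 2
    simp
    ring

lemma abs_mul_fst_add_snd_le_gauge {c : ℝ} (hc : |c| = 1 / 4) (p : ℝ × ℝ) :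
    |c * p.1 + p.2| ≤ gauge (convexHull ℝ Eset) p := by
  let φ : (ℝ × ℝ) →ₗ[ℝ] ℝ := c • LinearMap.fst ℝ ℝ ℝ + LinearMap.snd ℝ ℝ ℝ
  have hφ : ∀ q, φ q = c * q.1 + q.2 := fun q => rfl
  have hsub : convexHull ℝ Eset ⊆ φ ⁻¹' Set.Icc (-1) 1 :=
    convexHull_min (fun q hq => abs_le.1 (abs_mul_fst_add_snd_le_one_of_mem_Eset hc hq))
      ((convex_Icc (-1 : ℝ) 1).linear_preimage φ)
  refine le_csInf absorbent_convexHull_Eset.gauge_set_nonempty ?_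
  rintro r ⟨hr, q, hq, rfl⟩
  have hq1 : |φ q| ≤ 1 := abs_le.2 (hsub hq)
  have : |φ (r • q)| ≤ r := by
    rw [map_smul, smul_eq_mul, abs_mul, abs_of_pos hr]
    nlinarith
  exact this

lemma gauge_zero_snd_le (y : ℝ) : gauge (convexHull ℝ Eset) (0, y) ≤ |y| := by
  have h : ∀ s : ℝ, |s| = 1 → gauge (convexHull ℝ Eset) (0, s) ≤ 1 := fun s hs =>
    gauge_le_one_of_mem (axis_mem_convexHull hs.le).2
  have hy : ((0, y) : ℝ × ℝ) = |y| • ((0, if 0 ≤ y then 1 else -1) : ℝ × ℝ) := by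
    split_ifs with hy
    · simp [abs_of_nonneg hy]
    · simp [abs_of_neg (not_le.1 hy)]
  rw [hy, gauge_smul_of_nonneg (abs_nonneg y), smul_eq_mul]
  exact mul_le_of_le_one_right (abs_nonneg y) (h _ (by split_ifs <;> simp))

lemma gauge_zero_snd_lt {x : ℝ} (hx : 0 < x) (y : ℝ) :
    gauge (convexHull ℝ Eset) (0, y) < gauge (convexHull ℝ Eset) (x, y) := by
  refine (gauge_zero_snd_le y).trans_lt ?_
  have h1 := abs_mul_fst_add_snd_le_gauge (c := 1 / 4) (by norm_num) (x, y)
  have h2 := abs_mul_fst_add_snd_le_gauge (c := -(1 / 4)) (by norm_num) (x, y)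
  have h3 := le_abs_self (1 / 4 * x + y)
  have h4 := neg_le_abs (-(1 / 4) * x + y)
  refine abs_lt.2 ⟨?_, ?_⟩ <;> simp only at h1 h2 <;> linarith

lemma gauge_strictMonoOn (y : ℝ) :
    StrictMonoOn (fun x : ℝ => gauge (convexHull ℝ Eset) (x, y)) (Set.Ici 0) := by
  intro a ha b _ hab
  have ha : 0 ≤ a := ha
  have hb : 0 < b := ha.trans_lt hab
  have h0 := gauge_zero_snd_lt hb y
  have hab1 : a / b < 1 := (div_lt_one hb).2 hab
  have hsplit : ((a, y) : ℝ × ℝ) = (1 - a / b) • ((0, y) : ℝ × ℝ) + (a / b) • (b, y) := by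
    ext <;> simp
    · field_simp
    · ring
  have h := gauge_add_le (convex_convexHull ℝ Eset) absorbent_convexHull_Eset
    ((1 - a / b) • ((0, y) : ℝ × ℝ)) ((a / b) • (b, y))
  rw [← hsplit, gauge_smul_of_nonneg (by linarith), gauge_smul_of_nonneg (by positivity),
    smul_eq_mul, smul_eq_mul] at h
  change gauge _ (a, y) < gauge _ (b, y)
  nlinarith

lemma gauge_abs_fst (x y : ℝ) :
    gauge (convexHull ℝ Eset) (|x|, y) = gauge (convexHull ℝ Eset) (x, y) := by
  rcases abs_choice x with h | h <;> rw [h]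
  exact gauge_reflectFst (x, y)

theorem stmt_9 (v : ℝ × ℝ) :
    gauge (convexHull ℝ Eset) (v - (1, 0)) = gauge (convexHull ℝ Eset) (v + (1, 0)) ↔
      v.1 = 0 := by
  obtain ⟨x, y⟩ := v
  simp only [Prod.mk_sub_mk, Prod.mk_add_mk, sub_zero, add_zero]
  rw [← gauge_abs_fst (x - 1), ← gauge_abs_fst (x + 1)]
  refine ((gauge_strictMonoOn y).injOn.eq_iff (abs_nonneg (x - 1)) (abs_nonneg (x + 1))).trans ?_
  rw [abs_eq_abs]
  constructor
  · rintro (h | h) <;> linarith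
  · rintro rfl
    norm_num
end

section
/- Let V be a real normed space and let v, w ∈ V be nonzero vectors with ‖v + w‖ = ‖v‖ + ‖w‖. Suppose v + w is an extreme point of the closed ball {u ∈ V | ‖u‖ ≤ ‖v + w‖}. Then v = (‖v‖/‖w‖)·w and v = (‖v‖/‖v + w‖)·(v + w). -/
theorem stmt_10 {V : Type*} [NormedAddCommGroup V] [NormedSpace ℝ V]
    (v w : V) (hv : v ≠ 0) (hw : w ≠ 0)
    (hnorm : ‖v + w‖ = ‖v‖ + ‖w‖)
    (hext : ∀ u u' : V, ‖u‖ ≤ ‖v + w‖ → ‖u'‖ ≤ ‖v + w‖ →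
      v + w = ((1 : ℝ) / 2) • (u + u') → u = u') :
    v = (‖v‖ / ‖w‖) • w ∧ v = (‖v‖ / ‖v + w‖) • (v + w) := by
  have ha : 0 < ‖v‖ := norm_pos_iff.mpr hv
  have hb : 0 < ‖w‖ := norm_pos_iff.mpr hw
  rw [hnorm] at hext ⊢
  generalize hav : ‖v‖ = a at *
  generalize hbw : ‖w‖ = b at *
  have hab : 0 < a + b := add_pos ha hb
  have hcomb : ∀ p q : ℝ, 0 ≤ p → 0 ≤ q → p * a + q * b = a + b →
      ‖p • v + q • w‖ ≤ a + b := by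
    intro p q hp hq h
    calc ‖p • v + q • w‖ ≤ ‖p • v‖ + ‖q • w‖ := norm_add_le _ _
      _ = a + b := by
        rw [norm_smul_of_nonneg hp, norm_smul_of_nonneg hq, hav, hbw, h]
  have hp : b / (a + b) ≤ 1 := (div_le_one hab).mpr (by linarith)
  have hq : a / (a + b) ≤ 1 := (div_le_one hab).mpr (by linarith)
  have hp₀ : 0 ≤ b / (a + b) := by positivity
  have hq₀ : 0 ≤ a / (a + b) := by positivity
  have heq := hext ((1 + b / (a + b)) • v + (1 - a / (a + b)) • w)
    ((1 - b / (a + b)) • v + (1 + a / (a + b)) • w)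
    (hcomb _ _ (by linarith) (by linarith) (by ring))
    (hcomb _ _ (by linarith) (by linarith) (by ring))
    (by module)
  have hsmul : (b / (a + b)) • v = (a / (a + b)) • w := by
    linear_combination (norm := module) ((1 : ℝ) / 2) • heq
  have hvw : v = (a / b) • w := by
    calc v = ((a + b) / b) • (b / (a + b)) • v := by
          rw [smul_smul, div_mul_div_cancel₀' hab.ne', div_self hb.ne', one_smul]
      _ = (a / b) • w := by
          rw [hsmul, smul_smul]
          congr 1
          field_simp
  refine ⟨hvw, ?_⟩
  rw [smul_add, ← hsmul, ← add_smul, ← add_div, div_self hab.ne', one_smul]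
end

section
/- Let V be a real vector space and let x₁, …, xₙ and y₁, …, yₘ be vectors in V. Then there exists a norm N on V such that N(xᵢ) ≤ 1 for all 1 ≤ i ≤ n and N(yⱼ) ≥ 1 for all 1 ≤ j ≤ m if and only if no yₖ can be written as yₖ = ∑_{i=1}^n cᵢ·xᵢ with ∑_{i=1}^n |cᵢ| < 1. -/
/-- `N` is a norm on the real vector space `V`. -/
def IsNorm {V : Type*} [AddCommGroup V] [Module ℝ V] (N : V → ℝ) : Prop :=
  (∀ v, 0 ≤ N v) ∧ (∀ v, N v = 0 ↔ v = 0) ∧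
    (∀ (a : ℝ) v, N (a • v) = |a| * N v) ∧ ∀ v w, N (v + w) ≤ N v + N w

/-- The norm of a real normed space pulls back to a norm along an injective linear map. -/
theorem IsNorm.of_injective {V E : Type*} [AddCommGroup V] [Module ℝ V]
    [NormedAddCommGroup E] [NormedSpace ℝ E] (f : V →ₗ[ℝ] E) (hf : Function.Injective f) :
    IsNorm fun v => ‖f v‖ := by
  refine ⟨fun v => norm_nonneg _, fun v => ?_, fun a v => ?_, fun v w => ?_⟩
  · rw [norm_eq_zero, map_eq_zero_iff f hf]
  · simp [norm_smul]
  · simpa using norm_add_le (f v) (f w)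

/-- Every real vector space carries a norm, namely the `ℓ¹` norm in a Hamel basis. -/
theorem IsNorm.exists_norm (V : Type*) [AddCommGroup V] [Module ℝ V] :
    ∃ N : V → ℝ, IsNorm N := by
  classical
  let b := Module.Basis.ofVectorSpace ℝ V
  refine ⟨fun v => ∑ i ∈ (b.repr v).support, |b.repr v i|,
    fun v => by positivity, fun v => ?_, fun a v => ?_, fun v w => ?_⟩
  · rw [Finset.sum_eq_zero_iff_of_nonneg fun _ _ => abs_nonneg _]
    refine ⟨fun h => ?_, fun h => by simp [h]⟩
    rw [← b.repr.map_eq_zero_iff]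
    ext i
    by_contra hi
    exact hi (abs_eq_zero.1 (h i (Finsupp.mem_support_iff.2 hi)))
  · simp only [map_smul]
    rw [Finset.mul_sum, Finset.sum_subset (Finsupp.support_smul (b := a) (g := b.repr v))]
    · simp [abs_mul]
    · intro i _ hi
      simpa [or_iff_not_imp_left] using hi
  · have extend (u : V) (s : Finset _) (hs : (b.repr u).support ⊆ s) :
        ∑ i ∈ (b.repr u).support, |b.repr u i| = ∑ i ∈ s, |b.repr u i| :=
      Finset.sum_subset hs fun i _ hi => by simpa using hi
    beta_reduce
    rw [extend v _ Finset.subset_union_left,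
      extend w ((b.repr v).support ∪ (b.repr w).support) Finset.subset_union_right,
      extend (v + w) ((b.repr v).support ∪ (b.repr w).support)
        (by rw [map_add]; exact Finsupp.support_add), ← Finset.sum_add_distrib]
    exact Finset.sum_le_sum fun i _ => by simpa using abs_add_le (b.repr v i) (b.repr w i)

/-- The range of a linear map from a finite-dimensional normed space carries a norm (the quotient
norm) for which the map does not increase norms, and every vector of norm less than `1` is the
image of such a vector. -/
theorem IsNorm.exists_norm_range {V E : Type*} [AddCommGroup V] [Module ℝ V]
    [NormedAddCommGroup E] [NormedSpace ℝ E] [FiniteDimensional ℝ E] (L : E →ₗ[ℝ] V) :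
    ∃ g : L.range → ℝ, IsNorm g ∧ (∀ c, g (L.rangeRestrict c) ≤ ‖c‖) ∧
      ∀ w, g w < 1 → ∃ c, ‖c‖ < 1 ∧ L c = w := by
  have : IsClosed (L.ker : Set E) := Submodule.closed_of_finiteDimensional _
  let e := L.quotKerEquivRange
  refine ⟨_, IsNorm.of_injective e.symm.toLinearMap e.symm.injective, fun c => ?_, fun w hw => ?_⟩
  · have h : e.symm (L.rangeRestrict c) = Submodule.Quotient.mk c := by
      rw [LinearEquiv.symm_apply_eq]
      rfl
    simpa [h] using Submodule.Quotient.norm_mk_le L.ker c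
  · obtain ⟨c, hc, hc1⟩ := Submodule.Quotient.norm_mk_lt (S := L.ker) (e.symm w)
      (sub_pos.2 hw)
    refine ⟨c, by simpa using hc1, ?_⟩
    rw [eq_comm, LinearEquiv.symm_apply_eq] at hc
    rw [hc]
    rfl

/-- A norm on a subspace extends to the whole space, and the extension can be made at least `1` on
finitely many given vectors outside the subspace. -/
theorem IsNorm.exists_extension {V ι : Type*} [AddCommGroup V] [Module ℝ V] [Fintype ι]
    {W : Submodule ℝ V} {g : W → ℝ} (hg : IsNorm g) (y : ι → V) :
    ∃ N : V → ℝ, IsNorm N ∧ (∀ w : W, N w = g w) ∧ ∀ j, y j ∉ W → 1 ≤ N (y j) := by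
  obtain ⟨h, h0, hz, hs, ha⟩ := IsNorm.exists_norm (V ⧸ W)
  obtain ⟨g0, gz, gs, ga⟩ := hg
  obtain ⟨p, hp⟩ := W.subtype.exists_leftInverse_of_injective W.ker_subtype
  have hp (w : W) : p w = w := LinearMap.congr_fun hp w
  let M : ℝ := 1 + ∑ j, (h (W.mkQ (y j)))⁻¹
  have hsum : 0 ≤ ∑ j, (h (W.mkQ (y j)))⁻¹ :=
    Finset.sum_nonneg fun j _ => inv_nonneg.2 (h0 _)
  have hM : 0 < M := by positivity
  have hW (w : W) : h (W.mkQ w) = 0 := by simp [hz]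
  refine ⟨fun v => g (p v) + M * h (W.mkQ v), ⟨fun v => ?_, fun v => ?_, fun a v => ?_,
    fun v w => ?_⟩, fun w => ?_, fun j hj => ?_⟩
  · exact add_nonneg (g0 _) (mul_nonneg hM.le (h0 _))
  · refine ⟨fun hv => ?_, fun hv => by simp [hv, (gz 0).2, (hz 0).2]⟩
    rw [add_eq_zero_iff_of_nonneg (g0 _) (mul_nonneg hM.le (h0 _)), gz, mul_eq_zero,
      or_iff_right hM.ne', hz, Submodule.mkQ_apply, Submodule.Quotient.mk_eq_zero] at hv
    exact congrArg Subtype.val ((hp ⟨v, hv.2⟩).symm.trans hv.1)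
  · simp only [map_smul, gs, hs]
    ring
  · simp only [map_add]
    have h1 := ga (p v) (p w)
    have h2 := mul_le_mul_of_nonneg_left (ha (W.mkQ v) (W.mkQ w)) hM.le
    linarith
  · simp only [hp, hW, mul_zero, add_zero]
  · have hpos : 0 < h (W.mkQ (y j)) := (h0 _).lt_of_ne' fun hzero => hj <| by
      rwa [hz, Submodule.mkQ_apply, Submodule.Quotient.mk_eq_zero] at hzero
    have hle : (h (W.mkQ (y j)))⁻¹ ≤ M :=
      (Finset.single_le_sum (f := fun j => (h (W.mkQ (y j)))⁻¹)
        (fun i _ => inv_nonneg.2 (h0 _)) (Finset.mem_univ j)).trans (by simp [M])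
    have h1 := mul_le_mul_of_nonneg_right hle hpos.le
    rw [inv_mul_cancel₀ hpos.ne'] at h1
    exact h1.trans (le_add_of_nonneg_left (g0 _))

theorem IsNorm.sum_le {V ι : Type*} [AddCommGroup V] [Module ℝ V] {N : V → ℝ}
    (hN : IsNorm N) (s : Finset ι) (f : ι → V) : N (∑ i ∈ s, f i) ≤ ∑ i ∈ s, N (f i) :=
  Finset.le_sum_of_subadditive N ((hN.2.1 0).2 rfl).le hN.2.2.2 s f

theorem stmt_14 {V : Type*} [AddCommGroup V] [Module ℝ V]
    (n m : ℕ) (x : Fin n → V) (y : Fin m → V) :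
    (∃ N : V → ℝ, IsNorm N ∧ (∀ i, N (x i) ≤ 1) ∧ ∀ j, 1 ≤ N (y j)) ↔
      ¬ ∃ (k : Fin m) (c : Fin n → ℝ), (∑ i, |c i|) < 1 ∧ y k = ∑ i, c i • x i := by
  constructor
  · rintro ⟨N, hN, hx, hy⟩ ⟨k, c, hc, hk⟩
    refine ((hy k).trans ?_).not_gt hc
    rw [hk]
    refine (hN.sum_le _ _).trans (Finset.sum_le_sum fun i _ => ?_)
    rw [hN.2.2.1]
    exact mul_le_of_le_one_right (abs_nonneg _) (hx i)
  · intro hy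
    let L : PiLp 1 (fun _ : Fin n => ℝ) →ₗ[ℝ] V :=
      Fintype.linearCombination ℝ x ∘ₗ (WithLp.linearEquiv 1 ℝ (Fin n → ℝ)).toLinearMap
    have hL c : L c = ∑ i, c i • x i := by
      simp [L, Fintype.linearCombination_apply]
    have hnorm (c : PiLp 1 fun _ : Fin n => ℝ) : ‖c‖ = ∑ i, |c i| := by
      simp [PiLp.norm_eq_of_L1]
    obtain ⟨g, hg, hgx, hgy⟩ := IsNorm.exists_norm_range L
    obtain ⟨N, hN, hNg, hNy⟩ := hg.exists_extension y
    refine ⟨N, hN, fun i => ?_, fun j => ?_⟩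
    · have hi : L (WithLp.toLp 1 (Pi.single i 1)) = x i := by
        simp [hL]
      have hle : N (L (WithLp.toLp 1 (Pi.single i 1))) ≤ _ := (hNg _).trans_le (hgx _)
      rw [hi, hnorm] at hle
      refine hle.trans_eq ?_
      simp [Pi.single_apply, apply_ite abs]
    · by_cases hj : y j ∈ L.range
      · by_contra! hlt
        obtain ⟨c, hc, hcy⟩ := hgy ⟨y j, hj⟩ (by rwa [← hNg])
        exact hy ⟨j, c, by rwa [← hnorm], by rw [← hL, hcy]⟩
      · exact hNy j hj
end

section
/- Let V be a real vector space, let x₁, …, xₙ be vectors in V, and let b₁, …, bₙ be real numbers. Then there exists a norm N on V such that N(xᵢ) = bᵢ for all 1 ≤ i ≤ n if and only if: (i) bᵢ ≥ 0 for all i; (ii) for all i, if bᵢ = 0 then xᵢ = 0; and (iii) for each k there are no real numbers c₁, …, cₙ with xₖ = ∑_{i=1}^n cᵢ·xᵢ and ∑_{i=1}^n |cᵢ|·bᵢ < bₖ. -/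
/-- The weighted `ℓ¹` seminorm on `ι → ℝ`. -/
noncomputable def weightedSeminorm {ι : Type*} [Fintype ι] (b : ι → ℝ) (hb : ∀ i, 0 ≤ b i) :
    Seminorm ℝ (ι → ℝ) :=
  Seminorm.of (fun c => ∑ i, |c i| * b i)
    (fun c d => by
      rw [← Finset.sum_add_distrib]
      refine Finset.sum_le_sum fun i _ => ?_
      rw [← add_mul]
      exact mul_le_mul_of_nonneg_right (abs_add_le _ _) (hb i))
    (fun a c => by simp [abs_mul, Finset.mul_sum, mul_assoc])

theorem weightedSeminorm_apply {ι : Type*} [Fintype ι] (b : ι → ℝ) (hb : ∀ i, 0 ≤ b i)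
    (c : ι → ℝ) : weightedSeminorm b hb c = ∑ i, |c i| * b i := rfl

section InfConv

variable {E V : Type*} [AddCommGroup E] [Module ℝ E] [AddCommGroup V] [Module ℝ V]

theorem Seminorm.bddBelow_range_add_comp_sub (p : Seminorm ℝ E) (q : Seminorm ℝ V) (T : E →ₗ[ℝ] V)
    (v : V) : BddBelow (Set.range fun c => p c + q (v - T c)) :=
  ⟨0, by rintro _ ⟨c, rfl⟩; exact add_nonneg (apply_nonneg p c) (apply_nonneg q _)⟩

/-- The infimal convolution of `q` with the image of the seminorm `p` under `T`. -/
noncomputable def Seminorm.infConv (p : Seminorm ℝ E) (q : Seminorm ℝ V) (T : E →ₗ[ℝ] V) :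
    Seminorm ℝ V :=
  Seminorm.ofSMulLE (fun v => ⨅ c, p c + q (v - T c))
    (le_antisymm
      ((ciInf_le (p.bddBelow_range_add_comp_sub q T 0) 0).trans (by simp))
      (le_ciInf fun c => add_nonneg (apply_nonneg p c) (apply_nonneg q _)))
    (fun v w => le_ciInf_add_ciInf fun c d => by
      refine (ciInf_le (p.bddBelow_range_add_comp_sub q T (v + w)) (c + d)).trans ?_
      have h : v + w - T (c + d) = (v - T c) + (w - T d) := by rw [map_add]; abel
      have h₁ := map_add_le_add p c d
      have h₂ := map_add_le_add q (v - T c) (w - T d)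
      rw [h]
      linarith)
    (fun a v => by
      rw [Real.mul_iInf_of_nonneg (norm_nonneg a)]
      refine le_ciInf fun c => ?_
      refine (ciInf_le (p.bddBelow_range_add_comp_sub q T (a • v)) (a • c)).trans ?_
      rw [T.map_smul, ← smul_sub, map_smul_eq_mul, map_smul_eq_mul, mul_add])

theorem Seminorm.infConv_le (p : Seminorm ℝ E) (q : Seminorm ℝ V) (T : E →ₗ[ℝ] V) (v : V) (c : E) :
    p.infConv q T v ≤ p c + q (v - T c) :=
  ciInf_le (p.bddBelow_range_add_comp_sub q T v) c

theorem Seminorm.le_infConv {p : Seminorm ℝ E} {q : Seminorm ℝ V} {T : E →ₗ[ℝ] V} {v : V} {r : ℝ}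
    (h : ∀ c, r ≤ p c + q (v - T c)) : r ≤ p.infConv q T v :=
  le_ciInf h

end InfConv

/-- Every real vector space carries a norm. -/
theorem exists_seminorm_eq_zero_imp (V : Type*) [AddCommGroup V] [Module ℝ V] :
    ∃ p : Seminorm ℝ V, ∀ v, p v = 0 → v = 0 := by
  classical
  let B := Module.Basis.ofVectorSpace ℝ V
  have key (v : V) (s : Finset _) (hs : (B.repr v).support ⊆ s) :
      ((B.repr v).sum fun _ a => |a|) = ∑ i ∈ s, |B.repr v i| :=
    Finsupp.sum_of_support_subset _ hs _ (by simp)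
  refine ⟨Seminorm.of (fun v => (B.repr v).sum fun _ a => |a|) (fun v w => ?_) (fun a v => ?_),
    fun v hv => ?_⟩
  · let s := (B.repr v).support ∪ (B.repr w).support
    rw [key v s Finset.subset_union_left, key w s Finset.subset_union_right,
      key (v + w) s (by rw [map_add]; exact Finsupp.support_add), ← Finset.sum_add_distrib]
    refine Finset.sum_le_sum fun i _ => ?_
    rw [map_add]
    exact abs_add_le _ _
  · rw [key (a • v) (B.repr v).support (by rw [map_smul]; exact Finsupp.support_smul),
      key v _ subset_rfl, Finset.mul_sum]
    simp [abs_mul]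
  · change ∑ i ∈ (B.repr v).support, |B.repr v i| = 0 at hv
    rw [Finset.sum_eq_zero_iff_of_nonneg fun _ _ => abs_nonneg _] at hv
    refine B.repr.map_eq_zero_iff.mp (Finsupp.ext fun i => ?_)
    by_contra hi
    exact hi (abs_eq_zero.mp (hv i (Finsupp.mem_support_iff.mpr hi)))

/-- Every linear map between vector spaces has a generalized inverse. -/
theorem LinearMap.exists_apply_apply_apply_eq {K E F : Type*} [Field K] [AddCommGroup E]
    [Module K E] [AddCommGroup F] [Module K F] (T : E →ₗ[K] F) :
    ∃ s : F →ₗ[K] E, ∀ c, T (s (T c)) = T c := by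
  obtain ⟨g, hg⟩ := T.rangeRestrict.exists_rightInverse_of_surjective T.range_rangeRestrict
  obtain ⟨s, hs⟩ := g.exists_extend
  refine ⟨s, fun c => ?_⟩
  have h₁ : s (T c) = g (T.rangeRestrict c) := LinearMap.congr_fun hs (T.rangeRestrict c)
  have h₂ := congrArg Subtype.val (LinearMap.congr_fun hg (T.rangeRestrict c))
  rw [h₁]
  exact h₂

/-- A seminorm can be scaled to be bounded by prescribed weights on finitely many vectors. -/
theorem Seminorm.exists_pos_mul_le {V ι : Type*} [AddCommGroup V] [Module ℝ V] [Finite ι]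
    (p : Seminorm ℝ V) (x : ι → V) (b : ι → ℝ) (hb : ∀ i, 0 ≤ b i) (hx : ∀ i, b i = 0 → x i = 0) :
    ∃ ε : ℝ, 0 < ε ∧ ∀ i, ε * p (x i) ≤ b i := by
  have := Fintype.ofFinite ι
  have hnn (i : ι) : 0 ≤ p (x i) / b i := div_nonneg (apply_nonneg p _) (hb i)
  have hS : 0 < 1 + ∑ i, p (x i) / b i := by
    linarith [Finset.sum_nonneg fun i (_ : i ∈ Finset.univ) => hnn i]
  refine ⟨(1 + ∑ i, p (x i) / b i)⁻¹, inv_pos.mpr hS, fun i => ?_⟩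
  rcases (hb i).eq_or_lt with h | h
  · rw [hx i h.symm, map_zero, mul_zero]
    exact hb i
  · rw [inv_mul_le_iff₀ hS, ← div_le_iff₀ h]
    linarith [Finset.single_le_sum (fun i _ => hnn i) (Finset.mem_univ i)]

theorem Seminorm.isNorm {V : Type*} [AddCommGroup V] [Module ℝ V] (p : Seminorm ℝ V)
    (hp : ∀ v, p v = 0 → v = 0) : IsNorm p :=
  ⟨apply_nonneg p, fun v => ⟨hp v, fun h => by rw [h, map_zero]⟩,
    fun a v => map_smul_eq_mul p a v, map_add_le_add p⟩

theorem IsNorm.apply_sum_smul_le {V ι : Type*} [AddCommGroup V] [Module ℝ V] {N : V → ℝ}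
    (hN : IsNorm N) (s : Finset ι) (c : ι → ℝ) (x : ι → V) :
    N (∑ i ∈ s, c i • x i) ≤ ∑ i ∈ s, |c i| * N (x i) := by
  obtain ⟨-, h0, hsmul, hadd⟩ := hN
  simpa only [hsmul] using
    Finset.le_sum_of_subadditive N ((h0 0).mpr rfl).le hadd s fun i => c i • x i

theorem stmt_16 {V : Type*} [AddCommGroup V] [Module ℝ V]
    (n : ℕ) (x : Fin n → V) (b : Fin n → ℝ) :
    (∃ N : V → ℝ, IsNorm N ∧ ∀ i, N (x i) = b i) ↔
      ((∀ i, 0 ≤ b i) ∧ (∀ i, b i = 0 → x i = 0) ∧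
        ∀ k : Fin n, ¬ ∃ c : Fin n → ℝ, x k = ∑ i, c i • x i ∧ (∑ i, |c i| * b i) < b k) := by
  constructor
  · rintro ⟨N, hN, hx⟩
    refine ⟨fun i => hx i ▸ hN.1 _, fun i hi => (hN.2.1 _).mp ((hx i).trans hi), ?_⟩
    rintro k ⟨c, hc, hlt⟩
    have h := hN.apply_sum_smul_le Finset.univ c x
    rw [← hc] at h
    simp only [hx] at h
    exact hlt.not_ge h
  · rintro ⟨hb, hx, hc⟩
    obtain ⟨m, hm⟩ := exists_seminorm_eq_zero_imp V
    obtain ⟨ε, hε, hεx⟩ := m.exists_pos_mul_le x b hb hx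
    let T : (Fin n → ℝ) →ₗ[ℝ] V := Fintype.linearCombination ℝ x
    have hT (c : Fin n → ℝ) : T c = ∑ i, c i • x i := rfl
    have hTk (k : Fin n) : T (Pi.single k 1) = x k := by
      simp [T, Fintype.linearCombination_apply_single]
    obtain ⟨s, hs⟩ := T.exists_apply_apply_apply_eq
    let p := weightedSeminorm b hb
    -- `p.comp s` controls residuals inside the range of `T`; `δ • m` makes the result definite.
    let δ : NNReal := ⟨ε, hε.le⟩
    let q : Seminorm ℝ V := p.comp s + δ • m
    have hq (v : V) : q v = p (s v) + ε * m v := rfl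
    have hmT (c : Fin n → ℝ) : ε * m (T c) ≤ p c := by
      have h : m (T c) ≤ ∑ i, |c i| * m (x i) :=
        (m.isNorm hm).apply_sum_smul_le Finset.univ c x
      calc ε * m (T c) ≤ ε * ∑ i, |c i| * m (x i) := mul_le_mul_of_nonneg_left h hε.le
        _ = ∑ i, |c i| * (ε * m (x i)) := by
          rw [Finset.mul_sum]
          exact Finset.sum_congr rfl fun i _ => by ring
        _ ≤ ∑ i, |c i| * b i :=
          Finset.sum_le_sum fun i _ => mul_le_mul_of_nonneg_left (hεx i) (abs_nonneg _)
    have hle (v : V) : ε * m v ≤ p.infConv q T v := Seminorm.le_infConv fun c => by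
      have h₁ := map_add_le_add m (T c) (v - T c)
      rw [add_sub_cancel] at h₁
      have h₂ := mul_le_mul_of_nonneg_left h₁ hε.le
      have h₃ := apply_nonneg p (s (v - T c))
      rw [hq]
      linarith [hmT c]
    refine ⟨p.infConv q T, Seminorm.isNorm _ fun v hv => hm v ?_, fun k => le_antisymm ?_ ?_⟩
    · have h := hle v
      rw [hv] at h
      exact le_antisymm (nonpos_of_mul_nonpos_right h hε) (apply_nonneg m v)
    · refine (p.infConv_le q T (x k) (Pi.single k 1)).trans (le_of_eq ?_)
      rw [hTk, sub_self, map_zero, add_zero, weightedSeminorm_apply,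
        Finset.sum_eq_single k (fun i _ hi => by simp [hi]) (by simp)]
      simp
    · refine Seminorm.le_infConv fun c => ?_
      have hr : T (s (x k - T c)) = x k - T c := by
        rw [← hTk k, ← map_sub, hs]
      have h₁ : b k ≤ p (c + s (x k - T c)) := by
        refine not_lt.mp fun hlt => hc k ⟨_, ?_, hlt⟩
        rw [← hT, map_add, hr, add_sub_cancel]
      have h₂ := map_add_le_add p c (s (x k - T c))
      have h₃ := mul_nonneg hε.le (apply_nonneg m (x k - T c))
      rw [hq]
      linarith
end

section
/- For r ∈ ℝ define g_r : ℝ → ℝ by g_r(s) = 2s + s² + r·sin s. There exists ε > 0 such that for every r with 0 < r < ε, the function x ↦ g_r((x+1)/(−x)) / (1 + g_r((x+1)/(−x))) is concave on the open interval (−1, 0). -/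
/-- `g_r(s) = 2s + s² + r·sin s`. -/
noncomputable def g (r s : ℝ) : ℝ := 2 * s + s ^ 2 + r * Real.sin s

/-- The derivative of `x ↦ -1 - 1/x`, written as `(x + 1) / (-x)`. -/
lemma hasDerivAt_add_one_div_neg {x : ℝ} (hx : x ≠ 0) :
    HasDerivAt (fun y : ℝ => (y + 1) / (-y)) (1 / x ^ 2) x := by
  have h := ((hasDerivAt_id' x).add_const 1).fun_div (hasDerivAt_id' x).fun_neg (neg_ne_zero.mpr hx)
  refine h.congr_deriv ?_
  field_simp
  ring

/-- The function `x ↦ 1 + r x² sin (-1 - 1/x)`, equal to `x² (1 + g r (-1 - 1/x))`. -/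
noncomputable def gDenom (r x : ℝ) : ℝ := 1 + r * (x ^ 2 * Real.sin ((x + 1) / (-x)))

lemma hasDerivAt_gDenom (r : ℝ) {x : ℝ} (hx : x ≠ 0) :
    HasDerivAt (gDenom r)
      (r * (2 * x * Real.sin ((x + 1) / (-x)) + Real.cos ((x + 1) / (-x)))) x := by
  have h := ((((hasDerivAt_id' x).fun_pow 2).fun_mul
    (hasDerivAt_add_one_div_neg hx).sin).const_mul r).const_add 1
  refine h.congr_deriv ?_
  field_simp
  ring

lemma le_gDenom {r x : ℝ} (hr : 0 < r) (hr' : r < 1 / 100) (hx : x ∈ Set.Ioo (-1 : ℝ) 0) :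
    99 / 100 ≤ gDenom r x := by
  have hx2 : x ^ 2 ≤ 1 := by nlinarith [hx.1, hx.2]
  have h : |r * (x ^ 2 * Real.sin ((x + 1) / (-x)))| ≤ 1 / 100 * (1 * 1) := by
    rw [abs_mul, abs_mul, abs_of_pos hr, abs_of_nonneg (sq_nonneg x)]
    gcongr
    exact Real.abs_sin_le_one _
  unfold gDenom
  linarith [abs_le.mp h]

lemma g_div_one_add_g {r x : ℝ} (hx : x ≠ 0) (hD : gDenom r x ≠ 0) :
    g r ((x + 1) / (-x)) / (1 + g r ((x + 1) / (-x))) = 1 - x ^ 2 / gDenom r x := by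
  have h : 1 + g r ((x + 1) / (-x)) = gDenom r x / x ^ 2 := by
    unfold g gDenom
    generalize Real.sin ((x + 1) / (-x)) = S
    field_simp
    ring
  have h' : g r ((x + 1) / (-x)) = gDenom r x / x ^ 2 - 1 := by linarith
  rw [h, h']
  field_simp

lemma hasDerivAt_one_sub_sq_div_gDenom {r x : ℝ} (hx : x ≠ 0) (hD : gDenom r x ≠ 0) :
    HasDerivAt (fun y => 1 - y ^ 2 / gDenom r y)
      (-((2 * x - r * (x ^ 2 * Real.cos ((x + 1) / (-x)))) / gDenom r x ^ 2)) x := by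
  have h := (((hasDerivAt_id' x).fun_pow 2).fun_div (hasDerivAt_gDenom r hx) hD).const_sub 1
  refine h.congr_deriv ?_
  congr 2
  unfold gDenom
  push_cast
  ring

lemma hasDerivAt_deriv_one_sub_sq_div_gDenom {r x : ℝ} (hx : x ≠ 0) (hD : gDenom r x ≠ 0) :
    HasDerivAt (fun y => -((2 * y - r * (y ^ 2 * Real.cos ((y + 1) / (-y)))) / gDenom r y ^ 2))
      (-(((2 - r * (2 * x * Real.cos ((x + 1) / (-x)) - Real.sin ((x + 1) / (-x)))) * gDenom r x -
        2 * (2 * x - r * (x ^ 2 * Real.cos ((x + 1) / (-x)))) *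
          (r * (2 * x * Real.sin ((x + 1) / (-x)) + Real.cos ((x + 1) / (-x))))) /
        gDenom r x ^ 3)) x := by
  have hN := ((hasDerivAt_id' x).const_mul 2).fun_sub
    ((((hasDerivAt_id' x).fun_pow 2).fun_mul (hasDerivAt_add_one_div_neg hx).cos).const_mul r)
  have h := (hN.fun_div ((hasDerivAt_gDenom r hx).fun_pow 2) (pow_ne_zero 2 hD)).fun_neg
  refine h.congr_deriv ?_
  generalize gDenom r x = D at *
  generalize Real.sin ((x + 1) / (-x)) = S
  generalize Real.cos ((x + 1) / (-x)) = C
  field_simp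
  ring

lemma second_deriv_numerator_nonneg {r x S C D : ℝ} (hr : 0 < r) (hr' : r < 1 / 100)
    (hx : |x| ≤ 1) (hS : |S| ≤ 1) (hC : |C| ≤ 1) (hD : 99 / 100 ≤ D) :
    0 ≤ (2 - r * (2 * x * C - S)) * D - 2 * (2 * x - r * (x ^ 2 * C)) * (r * (2 * x * S + C)) := by
  have hxC : |x * C| ≤ 1 := by rw [abs_mul]; exact mul_le_one₀ hx (abs_nonneg _) hC
  have hxS : |x * S| ≤ 1 := by rw [abs_mul]; exact mul_le_one₀ hx (abs_nonneg _) hS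
  have hxxC : |x * (x * C)| ≤ 1 := by rw [abs_mul]; exact mul_le_one₀ hx (abs_nonneg _) hxC
  have h1 : r * (2 * x * C - S) ≤ 1 / 100 * 3 := by
    have : 2 * x * C - S ≤ 3 := by linarith [abs_le.mp hxC, abs_le.mp hS]
    nlinarith
  have hA : |2 * x - r * (x ^ 2 * C)| ≤ 3 := by
    have : |r * (x * (x * C))| ≤ 1 := by
      rw [abs_mul, abs_of_pos hr]; nlinarith [abs_nonneg (x * (x * C))]
    have e : r * (x ^ 2 * C) = r * (x * (x * C)) := by ring
    rw [e, abs_le]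
    constructor <;> linarith [abs_le.mp this, abs_le.mp hx]
  have hB : |r * (2 * x * S + C)| ≤ 1 / 100 * 3 := by
    rw [abs_mul, abs_of_pos hr]
    gcongr
    rw [abs_le]
    constructor <;> linarith [abs_le.mp hxS, abs_le.mp hC]
  have hAB : |(2 * x - r * (x ^ 2 * C)) * (r * (2 * x * S + C))| ≤ 3 * (1 / 100 * 3) := by
    rw [abs_mul]; gcongr
  have h2 : 1 ≤ (2 - r * (2 * x * C - S)) * D := by nlinarith
  linarith [abs_le.mp hAB]

theorem stmt_17 :
    ∃ ε : ℝ, 0 < ε ∧ ∀ r : ℝ, 0 < r → r < ε →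
      ConcaveOn ℝ (Set.Ioo (-1 : ℝ) 0)
        (fun x => g r ((x + 1) / (-x)) / (1 + g r ((x + 1) / (-x)))) := by
  refine ⟨1 / 100, by norm_num, fun r hr hr' => ?_⟩
  have hD : ∀ x ∈ Set.Ioo (-1 : ℝ) 0, 0 < gDenom r x := fun x hx => by
    linarith [le_gDenom hr hr' hx]
  have hconc : ConcaveOn ℝ (Set.Ioo (-1 : ℝ) 0) (fun x => 1 - x ^ 2 / gDenom r x) := by
    refine concaveOn_of_hasDerivWithinAt2_nonpos (convex_Ioo _ _)
      (fun x hx => (hasDerivAt_one_sub_sq_div_gDenom hx.2.ne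
        (hD x hx).ne').continuousAt.continuousWithinAt)
      (fun x hx => ?_) (fun x hx => ?_) (fun x hx => ?_)
      (f' := fun x => -((2 * x - r * (x ^ 2 * Real.cos ((x + 1) / (-x)))) / gDenom r x ^ 2))
      (f'' := fun x =>
        -(((2 - r * (2 * x * Real.cos ((x + 1) / (-x)) - Real.sin ((x + 1) / (-x)))) *
          gDenom r x - 2 * (2 * x - r * (x ^ 2 * Real.cos ((x + 1) / (-x)))) *
          (r * (2 * x * Real.sin ((x + 1) / (-x)) + Real.cos ((x + 1) / (-x))))) /
          gDenom r x ^ 3))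
    all_goals rw [interior_Ioo] at hx
    · exact (hasDerivAt_one_sub_sq_div_gDenom hx.2.ne (hD x hx).ne').hasDerivWithinAt
    · exact (hasDerivAt_deriv_one_sub_sq_div_gDenom hx.2.ne (hD x hx).ne').hasDerivWithinAt
    · exact neg_nonpos.mpr (div_nonneg
        (second_deriv_numerator_nonneg hr hr' (abs_le.mpr ⟨hx.1.le, by linarith [hx.2]⟩)
          (Real.abs_sin_le_one _) (Real.abs_cos_le_one _) (le_gDenom hr hr' hx))
        (pow_pos (hD x hx) 3).le)
  exact hconc.congr fun x hx => (g_div_one_add_g hx.2.ne (hD x hx).ne').symm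
end
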